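/- The slow basin B̃ contains both the fast basin B̂ and the basin B(A) of the attractor A. In particular, for every x ∈ B(A) and every infinite word ϑ ∈ {1,…,N}^∞, d(w_{θ_n} ∘ ⋯ ∘ w_{θ_1}(x), A) → 0 as n → ∞. -/

import Mathlib

open Set Metric Filter Topology

namespace FastBasinPaper

variable {X : Type*} [MetricSpace X]

/-- The Hutchinson operator of the IFS `w`. -/
def Hutch {N : ℕ} (w : Fin N → X ≃ₜ X) (S : Set X) : Set X := ⋃ i, (w i) '' S

/-- The (large) inverse-image operation `W⁻¹ : S ↦ ⋃ᵢ wᵢ⁻¹(S)`. -/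
def HutchInv {N : ℕ} (w : Fin N → X ≃ₜ X) (S : Set X) : Set X := ⋃ i, (w i) ⁻¹' S

/-- `A` is a strict attractor of the IFS `w`: a nonempty compact set such that for some
open `U ⊇ A`, `W^k(S) → A` in the Hausdorff metric for every nonempty compact `S ⊆ U`. -/
def IsStrictAttractor {N : ℕ} (w : Fin N → X ≃ₜ X) (A : Set X) : Prop :=
  A.Nonempty ∧ IsCompact A ∧ ∃ U : Set X, IsOpen U ∧ A ⊆ U ∧
    ∀ S : Set X, S.Nonempty → IsCompact S → S ⊆ U →
      Tendsto (fun k => hausdorffDist ((Hutch w)^[k] S) A) atTop (𝓝 0)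

/-- The basin of the attractor `A`: the largest open set witnessing the attraction. -/
def AttractorBasin {N : ℕ} (w : Fin N → X ≃ₜ X) (A : Set X) : Set X :=
  ⋃₀ {U : Set X | IsOpen U ∧ A ⊆ U ∧
    ∀ S : Set X, S.Nonempty → IsCompact S → S ⊆ U →
      Tendsto (fun k => hausdorffDist ((Hutch w)^[k] S) A) atTop (𝓝 0)}

/-- The fast basin of the attractor `A`. -/
def fastBasin {N : ℕ} (w : Fin N → X ≃ₜ X) (A : Set X) : Set X :=
  {x | ∃ k : ℕ, ((Hutch w)^[k] {x} ∩ A).Nonempty}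

/-- `w_{θ₁}⁻¹ ∘ ⋯ ∘ w_{θ_k}⁻¹` (with `θ_j = θ (j-1)`). -/
def invIter {N : ℕ} (w : Fin N → X ≃ₜ X) (θ : ℕ → Fin N) : ℕ → X → X
  | 0 => id
  | k + 1 => invIter w θ k ∘ (w (θ k)).symm

/-- The fractal continuation of `A` along the infinite word `θ`:
`⋃ₖ w_{θ₁}⁻¹ ∘ ⋯ ∘ w_{θ_k}⁻¹ (A)`. -/
def continuation {N : ℕ} (w : Fin N → X ≃ₜ X) (θ : ℕ → Fin N) (A : Set X) : Set X :=
  ⋃ k, invIter w θ k '' A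

/-- `w_{θ_k} ∘ ⋯ ∘ w_{θ₁}` (with `θ_j = θ (j-1)`). -/
def revIter {N : ℕ} (w : Fin N → X ≃ₜ X) (θ : ℕ → Fin N) : ℕ → X → X
  | 0 => id
  | k + 1 => (w (θ k)) ∘ revIter w θ k

/-- `w_{θ₁} ∘ ⋯ ∘ w_{θ_k}` for a finite word `[θ₁, …, θ_k]`. -/
def wordComp {N : ℕ} (w : Fin N → X ≃ₜ X) : List (Fin N) → X → X
  | [] => id
  | i :: t => (w i) ∘ wordComp w t

/-- `w_{θ_k} ∘ ⋯ ∘ w_{θ₁}` for a finite word `[θ₁, …, θ_k]`; the set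
`(revComp w l) ⁻¹' S` is the paper's `w_{θ₁..θ_k}⁻¹(S) = {x : w_{θ_k} ∘ ⋯ ∘ w_{θ₁}(x) ∈ S}`. -/
def revComp {N : ℕ} (w : Fin N → X ≃ₜ X) : List (Fin N) → X → X
  | [] => id
  | i :: t => revComp w t ∘ (w i)

/-- The slow basin of the attractor `A`: points `x` admitting an infinite word `θ` with
`d(w_{θ_n} ∘ ⋯ ∘ w_{θ₁}(x), A) → 0`. -/
def slowBasin {N : ℕ} (w : Fin N → X ≃ₜ X) (A : Set X) : Set X :=
  {x | ∃ θ : ℕ → Fin N, Tendsto (fun n => infDist (revIter w θ n x) A) atTop (𝓝 0)}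

/-- A porous subset of a metric space. -/
def Porous (S : Set X) : Prop :=
  ∃ lam : ℝ, 0 < lam ∧ lam < 1 ∧ ∃ r₀ : ℝ, 0 < r₀ ∧ ∀ s ∈ S, ∀ r : ℝ, 0 < r → r < r₀ →
    ∃ x : X, ball x (lam * r) ⊆ ball s r \ S

/-- A σ-porous subset of a metric space: a countable union of porous sets. -/
def SigmaPorous (S : Set X) : Prop :=
  ∃ f : ℕ → Set X, (∀ n, Porous (f n)) ∧ S = ⋃ n, f n

theorem mem_Hutch {N : ℕ} {w : Fin N → X ≃ₜ X} {S : Set X} {y : X} :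
    y ∈ Hutch w S ↔ ∃ i, ∃ x ∈ S, w i x = y := by
  simp [Hutch]

theorem isCompact_Hutch_iterate {N : ℕ} (w : Fin N → X ≃ₜ X) {S : Set X} (hS : IsCompact S)
    (k : ℕ) : IsCompact ((Hutch w)^[k] S) := by
  induction k with
  | zero => exact hS
  | succ k ih =>
    rw [Function.iterate_succ_apply']
    exact isCompact_iUnion fun i => ih.image (w i).continuous

theorem revIter_mem_Hutch_iterate {N : ℕ} (w : Fin N → X ≃ₜ X) (θ : ℕ → Fin N) (x : X) (k : ℕ) :
    revIter w θ k x ∈ (Hutch w)^[k] {x} := by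
  induction k with
  | zero => rfl
  | succ k ih =>
    rw [Function.iterate_succ_apply']
    exact mem_Hutch.2 ⟨θ k, _, ih, rfl⟩

theorem revIter_congr {N : ℕ} (w : Fin N → X ≃ₜ X) {θ θ' : ℕ → Fin N} {k : ℕ}
    (h : ∀ i < k, θ i = θ' i) : revIter w θ k = revIter w θ' k := by
  induction k with
  | zero => rfl
  | succ k ih =>
    simp only [revIter, h k k.lt_succ_self, ih fun i hi => h i (hi.trans k.lt_succ_self)]

theorem revIter_add {N : ℕ} (w : Fin N → X ≃ₜ X) (θ : ℕ → Fin N) (x : X) (k n : ℕ) :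
    revIter w θ (n + k) x = revIter w (fun j => θ (j + k)) n (revIter w θ k x) := by
  induction n with
  | zero => simp [revIter]
  | succ n ih =>
    rw [Nat.succ_add]
    simp only [revIter, Function.comp_apply, ih]

theorem exists_revIter_eq_of_mem_Hutch_iterate {N : ℕ} (hN : 0 < N) (w : Fin N → X ≃ₜ X) {x y : X}
    {k : ℕ} (hy : y ∈ (Hutch w)^[k] {x}) : ∃ θ : ℕ → Fin N, revIter w θ k x = y := by
  induction k generalizing y with
  | zero => exact ⟨fun _ => ⟨0, hN⟩, (mem_singleton_iff.1 hy).symm⟩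
  | succ k ih =>
    rw [Function.iterate_succ_apply'] at hy
    obtain ⟨i, z, hz, rfl⟩ := mem_Hutch.1 hy
    obtain ⟨θ, rfl⟩ := ih hz
    refine ⟨Function.update θ k i, ?_⟩
    rw [revIter, Function.comp_apply, Function.update_self,
      revIter_congr w (k := k) (θ' := θ) fun j hj => Function.update_of_ne hj.ne i θ]

theorem tendsto_infDist_revIter {N : ℕ} {w : Fin N → X ≃ₜ X} {A : Set X} (hne : A.Nonempty)
    (hA : IsCompact A) {x : X} (hx : x ∈ AttractorBasin w A) (θ : ℕ → Fin N) :
    Tendsto (fun n => infDist (revIter w θ n x) A) atTop (𝓝 0) := by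
  obtain ⟨U, ⟨-, -, hU⟩, hxU⟩ := hx
  refine squeeze_zero (fun _ => infDist_nonneg) (fun n => ?_)
    (hU {x} (singleton_nonempty x) isCompact_singleton (singleton_subset_iff.2 hxU))
  have hmem := revIter_mem_Hutch_iterate w θ x n
  exact infDist_le_hausdorffDist_of_mem hmem
    (hausdorffEDist_ne_top_of_nonempty_of_bounded ⟨_, hmem⟩ hne
      (isCompact_Hutch_iterate w isCompact_singleton n).isBounded hA.isBounded)

theorem IsStrictAttractor.subset_attractorBasin {N : ℕ} {w : Fin N → X ≃ₜ X} {A : Set X}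
    (hA : IsStrictAttractor w A) : A ⊆ AttractorBasin w A := by
  obtain ⟨-, -, U, hU⟩ := hA
  exact hU.2.1.trans (subset_sUnion_of_mem hU)

/-- the slow basin contains both the fast basin and the basin of the attractor;
in particular for every `x ∈ B(A)` and every infinite word `ϑ`,
`d(w_{θ_n} ∘ ⋯ ∘ w_{θ₁}(x), A) → 0`. -/
theorem statement14 {X : Type*} [MetricSpace X] [CompleteSpace X] {N : ℕ} (hN : 0 < N)
    (w : Fin N → X ≃ₜ X) (A : Set X) (hA : IsStrictAttractor w A) :
    fastBasin w A ⊆ slowBasin w A ∧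
    AttractorBasin w A ⊆ slowBasin w A ∧
    ∀ x ∈ AttractorBasin w A, ∀ θ : ℕ → Fin N,
      Tendsto (fun n => infDist (revIter w θ n x) A) atTop (𝓝 0) := by
  have key : ∀ x ∈ AttractorBasin w A, ∀ θ : ℕ → Fin N,
      Tendsto (fun n => infDist (revIter w θ n x) A) atTop (𝓝 0) :=
    fun x hx θ => tendsto_infDist_revIter hA.1 hA.2.1 hx θ
  refine ⟨?_, fun x hx => ⟨fun _ => ⟨0, hN⟩, key x hx _⟩, key⟩
  rintro x ⟨k, y, hy, hyA⟩
  obtain ⟨θ, rfl⟩ := exists_revIter_eq_of_mem_Hutch_iterate hN w hy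
  refine ⟨θ, (tendsto_add_atTop_iff_nat k).1 ?_⟩
  simpa only [revIter_add] using
    key _ (hA.subset_attractorBasin hyA) fun j => θ (j + k)
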